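/- arXiv:0912.1123 — 3 statements merged into one kernel-verified Lean document; each statement's English description precedes it below -/
import Mathlib

section
/- Let T > 0, ω ∈ ℝ, let g : [0,T] → ℂ be continuously differentiable with g(T) = 0, and let θ : [0,T] → ℂ be twice continuously differentiable with θ(0) = 0. Then the following are equivalent: (i) θ satisfies the Volterra equation of the second kind θ'(t) + ∫ₜᵀ e^{−iω(s−t)} (θ(s) − iω θ'(s)) ds = g(t) for all t ∈ [0,T]; (ii) θ satisfies the ODE θ''(t) − θ(t) = g'(t) − iω g(t) for all t ∈ [0,T], together with θ'(T) = 0. -/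
open Set

/-- The integral `∫ₜᵀ e^{−a(s−t)} f(s) ds`, as a function of its lower endpoint `t`, has
derivative `a ∫ₜᵀ e^{−a(s−t)} f(s) ds − f(t)`. -/
theorem hasDerivWithinAt_integral_exp_mul {T : ℝ} (a : ℂ) {f : ℝ → ℂ}
    (hf : ContinuousOn f (Icc 0 T)) {t : ℝ} (ht : t ∈ Icc 0 T) :
    HasDerivWithinAt
      (fun t : ℝ => ∫ s in t..T, Complex.exp (-(a * ((s : ℂ) - (t : ℂ)))) * f s)
      (a * (∫ s in t..T, Complex.exp (-(a * ((s : ℂ) - (t : ℂ)))) * f s) - f t)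
      (Icc 0 T) t := by
  have hfactor : ∀ t : ℝ, (∫ s in t..T, Complex.exp (-(a * ((s : ℂ) - (t : ℂ)))) * f s) =
      Complex.exp (a * t) * ∫ s in t..T, Complex.exp (-(a * s)) * f s := by
    intro t
    rw [← intervalIntegral.integral_const_mul]
    congr 1
    ext s
    rw [← mul_assoc, ← Complex.exp_add]
    ring_nf
  have hcont : ContinuousOn (fun s : ℝ => Complex.exp (-(a * s)) * f s) (Icc 0 T) :=
    ContinuousOn.mul (by fun_prop) hf
  have hint : IntervalIntegrable (fun s : ℝ => Complex.exp (-(a * s)) * f s)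
      MeasureTheory.volume t T := by
    apply ContinuousOn.intervalIntegrable
    rw [uIcc_of_le ht.2]
    exact hcont.mono (Icc_subset_Icc_left ht.1)
  have : Fact (t ∈ Icc 0 T) := ⟨ht⟩
  have hI : HasDerivWithinAt (fun t : ℝ => ∫ s in t..T, Complex.exp (-(a * s)) * f s)
      (-(Complex.exp (-(a * t)) * f t)) (Icc 0 T) t :=
    intervalIntegral.integral_hasDerivWithinAt_left hint
      (hcont.stronglyMeasurableAtFilter_nhdsWithin measurableSet_Icc t) (hcont t ht)
  have hexp : HasDerivWithinAt (fun t : ℝ => Complex.exp (a * t))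
      (Complex.exp (a * t) * (a * 1)) (Icc 0 T) t :=
    ((Complex.ofRealCLM.hasDerivAt.const_mul a).cexp).hasDerivWithinAt
  simp only [hfactor]
  refine (hexp.mul hI).congr_deriv ?_
  have hinv : Complex.exp (a * t) * Complex.exp (-(a * t)) = 1 := by
    rw [← Complex.exp_add, add_neg_cancel, Complex.exp_zero]
  linear_combination -f t * hinv

/-- A solution of `R' = a R` on `[0, T]` with `R(T) = 0` vanishes. -/
theorem eq_zero_of_hasDerivWithinAt_mul {T : ℝ} (a : ℂ) {R : ℝ → ℂ}
    (hR : ∀ t ∈ Icc 0 T, HasDerivWithinAt R (a * R t) (Icc 0 T) t) (hRT : R T = 0) :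
    ∀ t ∈ Icc 0 T, R t = 0 := by
  intro t ht
  have hT : (0 : ℝ) ≤ T := ht.1.trans ht.2
  have hderiv : ∀ t ∈ Icc 0 T,
      HasDerivWithinAt (fun t : ℝ => Complex.exp (-a * t) * R t) 0 (Icc 0 T) t := by
    intro t ht
    have hexp : HasDerivWithinAt (fun t : ℝ => Complex.exp (-a * t))
        (Complex.exp (-a * t) * (-a * 1)) (Icc 0 T) t :=
      ((Complex.ofRealCLM.hasDerivAt.const_mul (-a)).cexp).hasDerivWithinAt
    exact (hexp.mul (hR t ht)).congr_deriv (by ring)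
  have hconst : ∀ t ∈ Icc 0 T, Complex.exp (-a * t) * R t = Complex.exp (-a * (0 : ℝ)) * R 0 := by
    refine constant_of_has_deriv_right_zero
      (f := fun t : ℝ => Complex.exp (-a * t) * R t)
      (fun t ht => (hderiv t ht).continuousWithinAt) fun t ht => ?_
    exact (hderiv t (Ico_subset_Icc_self ht)).mono_of_mem_nhdsWithin
      (Icc_mem_nhdsGE_of_mem ht)
  have h := (hconst t ht).trans (hconst T (right_mem_Icc.2 hT)).symm
  rw [hRT, mul_zero] at h
  exact (mul_eq_zero.1 h).resolve_left (Complex.exp_ne_zero _)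



/-- Equivalence of the Volterra equation of the second kind
`θ'(t) + ∫ₜᵀ e^{−iω(s−t)} (θ(s) − iω θ'(s)) ds = g(t)` (with `θ(0) = 0`, `g(T) = 0`)
with the ODE `θ'' − θ = g' − iωg` together with `θ'(T) = 0`. -/
theorem stmt_2 (T : ℝ) (hT : 0 < T) (ω : ℝ) (g θ : ℝ → ℂ)
    (hg : ContDiffOn ℝ 1 g (Icc 0 T)) (hgT : g T = 0)
    (hθ : ContDiffOn ℝ 2 θ (Icc 0 T)) (hθ0 : θ 0 = 0) :
    (∀ t ∈ Icc 0 T,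
        derivWithin θ (Icc 0 T) t +
          (∫ s in t..T, Complex.exp (-(Complex.I * (ω : ℂ) * ((s : ℂ) - (t : ℂ)))) *
            (θ s - Complex.I * (ω : ℂ) * derivWithin θ (Icc 0 T) s)) = g t)
      ↔
    ((∀ t ∈ Icc 0 T,
        derivWithin (derivWithin θ (Icc 0 T)) (Icc 0 T) t - θ t =
          derivWithin g (Icc 0 T) t - Complex.I * (ω : ℂ) * g t) ∧
      derivWithin θ (Icc 0 T) T = 0) := by
  have huniq : UniqueDiffOn ℝ (Icc 0 T) := uniqueDiffOn_Icc hT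
  have hu : ContDiffOn ℝ 1 (derivWithin θ (Icc 0 T)) (Icc 0 T) :=
    hθ.derivWithin huniq (by norm_num)
  have hTmem : T ∈ Icc 0 T := right_mem_Icc.2 hT.le
  set u := derivWithin θ (Icc 0 T)
  set a : ℂ := Complex.I * (ω : ℂ)
  set J : ℝ → ℂ := fun t => ∫ s in t..T,
    Complex.exp (-(a * ((s : ℂ) - (t : ℂ)))) * (θ s - a * u s)
  have hJT : J T = 0 := intervalIntegral.integral_same
  have hderiv : ∀ t ∈ Icc 0 T, HasDerivWithinAt (fun t => u t + J t - g t)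
      (derivWithin u (Icc 0 T) t + (a * J t - (θ t - a * u t)) - derivWithin g (Icc 0 T) t)
      (Icc 0 T) t := fun t ht =>
    (((hu.differentiableOn one_ne_zero t ht).hasDerivWithinAt.add
      (hasDerivWithinAt_integral_exp_mul a
        (hθ.continuousOn.sub (continuousOn_const.mul hu.continuousOn)) ht)).sub
      (hg.differentiableOn one_ne_zero t ht).hasDerivWithinAt)
  change (∀ t ∈ Icc 0 T, u t + J t = g t) ↔ _
  constructor
  · intro h
    refine ⟨fun t ht => ?_, ?_⟩
    · have hzero : HasDerivWithinAt (fun t => u t + J t - g t) 0 (Icc 0 T) t :=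
        (hasDerivWithinAt_const t (Icc 0 T) (0 : ℂ)).congr
          (fun s hs => sub_eq_zero.2 (h s hs)) (sub_eq_zero.2 (h t ht))
      have hres := (huniq t ht).eq_deriv _ (hderiv t ht) hzero
      linear_combination hres - a * h t ht
    · simpa [hJT, hgT] using h T hTmem
  · rintro ⟨hode, huT⟩ t ht
    refine sub_eq_zero.1 (eq_zero_of_hasDerivWithinAt_mul (R := fun t => u t + J t - g t) a
      (fun t ht => (hderiv t ht).congr_deriv ?_) (by simp [hJT, hgT, huT]) t ht)
    linear_combination hode t ht
end

section
/- Let T > 0, ω ∈ ℝ, and let g : [0,T] → ℂ be continuous. Then there exists a unique continuously differentiable function θ : [0,T] → ℂ with θ(0) = 0 satisfying θ'(t) + ∫ₜᵀ e^{−iω(s−t)} (θ(s) − iω θ'(s)) ds = g(t) for all t ∈ [0,T]. -/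
open Set

/-- A continuous function on `[a, b]` extends to a continuous function on `ℝ`. -/
lemma ContinuousOn.exists_continuous_eqOn_Icc {a b : ℝ} (hab : a ≤ b) {f : ℝ → ℂ}
    (hf : ContinuousOn f (Icc a b)) : ∃ F : ℝ → ℂ, Continuous F ∧ EqOn F f (Icc a b) :=
  ⟨IccExtend hab ((Icc a b).domRestrict f), hf.domRestrict.Icc_extend',
    fun x hx => by simp [IccExtend_of_mem hab _ hx]⟩

/-- A function whose derivative vanishes within `[0, T]` takes its initial value throughout. -/
lemma eq_initial_of_hasDerivWithinAt_zero {T : ℝ} {f : ℝ → ℂ}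
    (hf : ∀ t ∈ Icc 0 T, HasDerivWithinAt f 0 (Icc 0 T) t) {t : ℝ} (ht : t ∈ Icc 0 T) :
    f t = f 0 :=
  constant_of_has_deriv_right_zero (fun x hx => (hf x hx).continuousWithinAt)
    (fun x hx => ((hf x (Ico_subset_Icc_self hx)).mono_of_mem_nhdsWithin
      (Icc_mem_nhdsGE_of_mem hx))) t ht

lemma hasDerivAt_cexp_mul_ofReal (c : ℂ) (t : ℝ) :
    HasDerivAt (fun s : ℝ => Complex.exp (c * s)) (c * Complex.exp (c * t)) t := by
  have h := ((Complex.ofRealCLM.hasDerivAt (x := t)).const_mul c).cexp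
  simpa [mul_comm] using h

/-- A solution of the Volterra equation solves, together with its integral term `p`, a linear
first order boundary value problem. -/
lemma exists_costate_of_volterra {T : ℝ} (hT : 0 < T) {ω : ℝ} {g θ : ℝ → ℂ}
    (hθ : ContDiffOn ℝ 1 θ (Icc 0 T))
    (h : ∀ t ∈ Icc 0 T,
      derivWithin θ (Icc 0 T) t +
        (∫ s in t..T, Complex.exp (-(Complex.I * (ω : ℂ) * ((s : ℂ) - (t : ℂ)))) *
          (θ s - Complex.I * (ω : ℂ) * derivWithin θ (Icc 0 T) s)) = g t) :
    ∃ p : ℝ → ℂ, p T = 0 ∧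
      (∀ t ∈ Icc 0 T, HasDerivWithinAt θ (g t - p t) (Icc 0 T) t) ∧
      ∀ t ∈ Icc 0 T, HasDerivWithinAt p (-θ t + Complex.I * ω * g t) (Icc 0 T) t := by
  have hd : ContinuousOn (derivWithin θ (Icc 0 T)) (Icc 0 T) :=
    hθ.continuousOn_derivWithin (uniqueDiffOn_Icc hT) le_rfl
  obtain ⟨Φ, hΦc, hΦ⟩ := ContinuousOn.exists_continuous_eqOn_Icc hT.le
    (f := fun s => Complex.exp (-(Complex.I * ω) * s) *
      (θ s - Complex.I * ω * derivWithin θ (Icc 0 T) s))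
    (ContinuousOn.mul (by fun_prop) (hθ.continuousOn.sub (continuousOn_const.mul hd)))
  have key : ∀ t ∈ Icc 0 T, derivWithin θ (Icc 0 T) t =
      g t - Complex.exp (Complex.I * ω * t) * ∫ s in t..T, Φ s := by
    intro t ht
    rw [← h t ht, ← intervalIntegral.integral_const_mul, eq_sub_iff_add_eq]
    congr 1
    refine intervalIntegral.integral_congr fun s hs => ?_
    rw [uIcc_of_le ht.2] at hs
    simp only [hΦ ⟨ht.1.trans hs.1, hs.2⟩, ← mul_assoc, ← Complex.exp_add]
    ring_nf
  refine ⟨fun t => Complex.exp (Complex.I * ω * t) * ∫ s in t..T, Φ s, by simp,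
    fun t ht => ?_, fun t ht => ?_⟩
  · rw [← key t ht]
    exact ((hθ.differentiableOn one_ne_zero) t ht).hasDerivWithinAt
  · have h1 : HasDerivAt (fun t => ∫ s in t..T, Φ s) (-Φ t) t :=
      intervalIntegral.integral_hasDerivAt_left (hΦc.intervalIntegrable _ _)
        (hΦc.stronglyMeasurableAtFilter _ _) hΦc.continuousAt
    have h2 := (hasDerivAt_cexp_mul_ofReal (Complex.I * ω) t).mul h1
    refine (h2.congr_deriv ?_).hasDerivWithinAt
    have he : Complex.exp (Complex.I * ω * t) * Complex.exp (-(Complex.I * ω) * t) = 1 := by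
      rw [← Complex.exp_add]; simp
    rw [hΦ ht]
    linear_combination (Complex.I * ω) * key t ht -
      (θ t - Complex.I * ω * derivWithin θ (Icc 0 T) t) * he

/-- A solution of the boundary value problem yields a solution of the Volterra equation. -/
lemma volterra_of_costate {T : ℝ} (hT : 0 < T) {ω : ℝ} {g θ p : ℝ → ℂ}
    (hg : ContinuousOn g (Icc 0 T)) (hpT : p T = 0)
    (hθ : ∀ t ∈ Icc 0 T, HasDerivWithinAt θ (g t - p t) (Icc 0 T) t)
    (hp : ∀ t ∈ Icc 0 T, HasDerivWithinAt p (-θ t + Complex.I * ω * g t) (Icc 0 T) t) :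
    ContDiffOn ℝ 1 θ (Icc 0 T) ∧ ∀ t ∈ Icc 0 T,
      derivWithin θ (Icc 0 T) t +
        (∫ s in t..T, Complex.exp (-(Complex.I * (ω : ℂ) * ((s : ℂ) - (t : ℂ)))) *
          (θ s - Complex.I * (ω : ℂ) * derivWithin θ (Icc 0 T) s)) = g t := by
  have hu := uniqueDiffOn_Icc hT
  have hd : EqOn (derivWithin θ (Icc 0 T)) (fun t => g t - p t) (Icc 0 T) :=
    fun t ht => (hθ t ht).derivWithin (hu t ht)
  have hθc : ContinuousOn θ (Icc 0 T) := fun t ht => (hθ t ht).continuousWithinAt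
  have hpc : ContinuousOn p (Icc 0 T) := fun t ht => (hp t ht).continuousWithinAt
  have hdc : ContinuousOn (derivWithin θ (Icc 0 T)) (Icc 0 T) := (hg.sub hpc).congr hd
  refine ⟨(contDiffOn_one_iff_derivWithin hu).2
    ⟨fun t ht => (hθ t ht).differentiableWithinAt, hdc⟩, fun t ht => ?_⟩
  have hsub : Icc t T ⊆ Icc 0 T := Icc_subset_Icc_left ht.1
  have hE : ∀ s : ℝ, HasDerivAt
      (fun s : ℝ => Complex.exp (-(Complex.I * (ω : ℂ) * ((s : ℂ) - (t : ℂ)))))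
      (-(Complex.I * ω) * Complex.exp (-(Complex.I * (ω : ℂ) * ((s : ℂ) - (t : ℂ))))) s := by
    intro s
    have h := ((((Complex.ofRealCLM.hasDerivAt (x := s)).sub_const (t : ℂ)).const_mul
      (Complex.I * (ω : ℂ))).neg).cexp
    simpa [mul_comm] using h
  have hint := intervalIntegral.integral_eq_sub_of_hasDerivAt_of_le ht.2
    (f := fun s => -(Complex.exp (-(Complex.I * (ω : ℂ) * ((s : ℂ) - (t : ℂ)))) * p s))
    (f' := fun s => Complex.exp (-(Complex.I * (ω : ℂ) * ((s : ℂ) - (t : ℂ)))) *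
          (θ s - Complex.I * (ω : ℂ) * derivWithin θ (Icc 0 T) s))
    (ContinuousOn.neg (ContinuousOn.mul (by fun_prop) (hpc.mono hsub)))
    (fun s hs => by
      have hs' : s ∈ Icc 0 T := hsub (Ioo_subset_Icc_self hs)
      have hps := (hp s hs').hasDerivAt (Icc_mem_nhds (ht.1.trans_lt hs.1) hs.2)
      refine ((hE s).mul hps).neg.congr_deriv ?_
      rw [hd hs']
      ring)
    (ContinuousOn.intervalIntegrable (by
      rw [uIcc_of_le ht.2]
      exact ContinuousOn.mul (by fun_prop)
        ((hθc.sub (continuousOn_const.mul hdc)).mono hsub)))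
  rw [hint, hd ht]
  simp [hpT]

/-- The boundary value problem is solvable, by variation of constants. -/
lemma exists_costate_system {T : ℝ} (ω : ℝ) {g : ℝ → ℂ} (hg : Continuous g) :
    ∃ θ p : ℝ → ℂ, θ 0 = 0 ∧ p T = 0 ∧ (∀ t, HasDerivAt θ (g t - p t) t) ∧
      ∀ t, HasDerivAt p (-θ t + Complex.I * ω * g t) t := by
  have hexp : ∀ t : ℝ, Complex.exp (-1 * t) * Complex.exp (1 * t) = 1 := fun t => by
    rw [← Complex.exp_add]; simp
  have hden : Complex.exp (1 * T) + Complex.exp (-1 * T) ≠ 0 := by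
    have h : Real.exp T + Real.exp (-T) ≠ 0 := by positivity
    simpa using (Complex.ofReal_ne_zero.2 h)
  have hI : ∀ c : ℂ, ∀ t : ℝ, HasDerivAt (fun t : ℝ => ∫ s in (0 : ℝ)..t, Complex.exp (c * s) * g s)
      (Complex.exp (c * t) * g t) t := fun c t =>
    (show Continuous fun s : ℝ => Complex.exp (c * s) * g s by fun_prop).integral_hasStrictDerivAt
      0 t |>.hasDerivAt
  set A : ℝ → ℂ := fun t => ∫ s in (0 : ℝ)..t, Complex.exp (1 * s) * g s with hA
  set B : ℝ → ℂ := fun t => ∫ s in (0 : ℝ)..t, Complex.exp (-1 * s) * g s with hB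
  obtain ⟨a, ha⟩ : ∃ a : ℂ, Complex.exp (-1 * T) * (a + (1 + Complex.I * ω) * A T) =
      Complex.exp (1 * T) * (-a + (1 - Complex.I * ω) * B T) :=
    ⟨(Complex.exp (1 * T) * ((1 - Complex.I * ω) * B T) -
      Complex.exp (-1 * T) * ((1 + Complex.I * ω) * A T)) /
        (Complex.exp (1 * T) + Complex.exp (-1 * T)), by
          linear_combination div_mul_cancel₀ (Complex.exp (1 * T) * ((1 - Complex.I * ω) * B T) -
            Complex.exp (-1 * T) * ((1 + Complex.I * ω) * A T)) hden⟩
  have hu : ∀ t : ℝ, HasDerivAt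
      (fun t : ℝ => Complex.exp (-1 * t) * (a + (1 + Complex.I * ω) * A t))
      (-(Complex.exp (-1 * t) * (a + (1 + Complex.I * ω) * A t)) + (1 + Complex.I * ω) * g t)
      t := fun t =>
    ((hasDerivAt_cexp_mul_ofReal (-1) t).mul
      (((hI 1 t).const_mul (1 + Complex.I * ω)).const_add a)).congr_deriv (by
        linear_combination (1 + Complex.I * ω) * g t * hexp t)
  have hv : ∀ t : ℝ, HasDerivAt
      (fun t : ℝ => Complex.exp (1 * t) * (-a + (1 - Complex.I * ω) * B t))
      (Complex.exp (1 * t) * (-a + (1 - Complex.I * ω) * B t) + (1 - Complex.I * ω) * g t)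
      t := fun t =>
    ((hasDerivAt_cexp_mul_ofReal 1 t).mul
      (((hI (-1) t).const_mul (1 - Complex.I * ω)).const_add (-a))).congr_deriv (by
        linear_combination (1 - Complex.I * ω) * g t * hexp t)
  refine ⟨fun t => (Complex.exp (-1 * t) * (a + (1 + Complex.I * ω) * A t) +
      Complex.exp (1 * t) * (-a + (1 - Complex.I * ω) * B t)) / 2,
    fun t => (Complex.exp (-1 * t) * (a + (1 + Complex.I * ω) * A t) -
      Complex.exp (1 * t) * (-a + (1 - Complex.I * ω) * B t)) / 2, ?_, ?_,
    fun t => (((hu t).add (hv t)).div_const 2).congr_deriv (by ring),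
    fun t => (((hu t).sub (hv t)).div_const 2).congr_deriv (by ring)⟩
  · simp [hA, hB]
  · simp only [ha, sub_self, zero_div]

/-- The homogeneous boundary value problem has only the trivial solution. -/
lemma eq_zero_of_costate_system {T : ℝ} (hT : 0 ≤ T) {θ p : ℝ → ℂ} (hθ0 : θ 0 = 0)
    (hpT : p T = 0) (hθ : ∀ t ∈ Icc 0 T, HasDerivWithinAt θ (-p t) (Icc 0 T) t)
    (hp : ∀ t ∈ Icc 0 T, HasDerivWithinAt p (-θ t) (Icc 0 T) t) {t : ℝ} (ht : t ∈ Icc 0 T) :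
    θ t = 0 := by
  have hu : ∀ t ∈ Icc 0 T, Complex.exp (1 * t) * (θ t + p t) = p 0 := fun t ht => by
    have h := eq_initial_of_hasDerivWithinAt_zero
      (f := fun t : ℝ => Complex.exp (1 * t) * (θ t + p t)) (fun s hs =>
      ((hasDerivAt_cexp_mul_ofReal 1 s).hasDerivWithinAt.mul
        ((hθ s hs).add (hp s hs))).congr_deriv (by simp only [Pi.add_apply]; ring)) ht
    simpa [hθ0] using h
  have hv : ∀ t ∈ Icc 0 T, Complex.exp (-1 * t) * (θ t - p t) = -p 0 := fun t ht => by
    have h := eq_initial_of_hasDerivWithinAt_zero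
      (f := fun t : ℝ => Complex.exp (-1 * t) * (θ t - p t)) (fun s hs =>
      ((hasDerivAt_cexp_mul_ofReal (-1) s).hasDerivWithinAt.mul
        ((hθ s hs).sub (hp s hs))).congr_deriv (by simp only [Pi.sub_apply]; ring)) ht
    simpa [hθ0] using h
  have hden : Complex.exp (1 * T) + Complex.exp (-1 * T) ≠ 0 := by
    have h : Real.exp T + Real.exp (-T) ≠ 0 := by positivity
    simpa using (Complex.ofReal_ne_zero.2 h)
  have hTm : T ∈ Icc 0 T := right_mem_Icc.2 hT
  have hθT : θ T = 0 := by
    have h : (Complex.exp (1 * T) + Complex.exp (-1 * T)) * θ T = 0 := by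
      linear_combination hu T hTm + hv T hTm -
        (Complex.exp (1 * T) - Complex.exp (-1 * T)) * hpT
    exact (mul_eq_zero.1 h).resolve_left hden
  have hp0 : p 0 = 0 := by simpa [hθT, hpT] using (hu T hTm).symm
  have h1 : θ t + p t = 0 := by simpa [hp0] using hu t ht
  have h2 : θ t - p t = 0 := by simpa [hp0] using hv t ht
  linear_combination (h1 + h2) / 2

/-- Existence and uniqueness of the continuously differentiable solution with `θ(0) = 0`
of the Volterra equation of the second kind
`θ'(t) + ∫ₜᵀ e^{−iω(s−t)} (θ(s) − iω θ'(s)) ds = g(t)` on `[0,T]`. -/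
theorem stmt_4 (T : ℝ) (hT : 0 < T) (ω : ℝ) (g : ℝ → ℂ)
    (hg : ContinuousOn g (Icc 0 T)) :
    (∃ θ : ℝ → ℂ, ContDiffOn ℝ 1 θ (Icc 0 T) ∧ θ 0 = 0 ∧
      ∀ t ∈ Icc 0 T,
        derivWithin θ (Icc 0 T) t +
          (∫ s in t..T, Complex.exp (-(Complex.I * (ω : ℂ) * ((s : ℂ) - (t : ℂ)))) *
            (θ s - Complex.I * (ω : ℂ) * derivWithin θ (Icc 0 T) s)) = g t) ∧
    (∀ θ₁ θ₂ : ℝ → ℂ,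
      (ContDiffOn ℝ 1 θ₁ (Icc 0 T) ∧ θ₁ 0 = 0 ∧
        ∀ t ∈ Icc 0 T,
          derivWithin θ₁ (Icc 0 T) t +
            (∫ s in t..T, Complex.exp (-(Complex.I * (ω : ℂ) * ((s : ℂ) - (t : ℂ)))) *
              (θ₁ s - Complex.I * (ω : ℂ) * derivWithin θ₁ (Icc 0 T) s)) = g t) →
      (ContDiffOn ℝ 1 θ₂ (Icc 0 T) ∧ θ₂ 0 = 0 ∧
        ∀ t ∈ Icc 0 T,
          derivWithin θ₂ (Icc 0 T) t +
            (∫ s in t..T, Complex.exp (-(Complex.I * (ω : ℂ) * ((s : ℂ) - (t : ℂ)))) *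
              (θ₂ s - Complex.I * (ω : ℂ) * derivWithin θ₂ (Icc 0 T) s)) = g t) →
      EqOn θ₁ θ₂ (Icc 0 T)) := by
  refine ⟨?_, ?_⟩
  · obtain ⟨G, hG, hGg⟩ := hg.exists_continuous_eqOn_Icc hT.le
    obtain ⟨θ, p, hθ0, hpT, hθ, hp⟩ := exists_costate_system (T := T) ω hG
    obtain ⟨hc, h⟩ := volterra_of_costate hT hG.continuousOn hpT
      (fun t _ => (hθ t).hasDerivWithinAt) (fun t _ => (hp t).hasDerivWithinAt)
    exact ⟨θ, hc, hθ0, fun t ht => (h t ht).trans (hGg ht)⟩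
  · rintro θ₁ θ₂ ⟨hc₁, h0₁, h₁⟩ ⟨hc₂, h0₂, h₂⟩ t ht
    obtain ⟨p₁, hpT₁, hθ₁, hp₁⟩ := exists_costate_of_volterra hT hc₁ h₁
    obtain ⟨p₂, hpT₂, hθ₂, hp₂⟩ := exists_costate_of_volterra hT hc₂ h₂
    refine sub_eq_zero.1 (eq_zero_of_costate_system hT.le (θ := θ₁ - θ₂) (p := p₁ - p₂)
      (by simp [h0₁, h0₂]) (by simp [hpT₁, hpT₂])
      (fun s hs => ((hθ₁ s hs).sub (hθ₂ s hs)).congr_deriv ?_)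
      (fun s hs => ((hp₁ s hs).sub (hp₂ s hs)).congr_deriv ?_) ht)
    · simp only [Pi.sub_apply]; ring
    · simp only [Pi.sub_apply]; ring
end

section
/- Let T > 0, ω ∈ ℝ, let g : [0,T] → ℂ and F : [0,T] → ℂ be continuous, and let θ : [0,T] → ℂ be continuously differentiable with θ(0) = 0 and satisfying the Volterra equation θ'(t) + ∫ₜᵀ e^{−iω(s−t)} (θ(s) − iω θ'(s)) ds = g(t) for all t ∈ [0,T]. Define V(t) = ∫₀ᵗ e^{−iωs} F(t − s) ds. Then ∫₀ᵀ ( θ(t) V(t) + θ'(t) V'(t) ) dt = ∫₀ᵀ g(t) F(t) dt. -/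
open Set

/-- The primitive `u ↦ ∫ₐᵘ f` of a function continuous on `[a, b]` has derivative `f` within
`[a, b]`, endpoints included. -/
theorem hasDerivWithinAt_integral_right_of_continuousOn_Icc {f : ℝ → ℂ} {a b x : ℝ}
    (hf : ContinuousOn f (Icc a b)) (hx : x ∈ Icc a b) :
    HasDerivWithinAt (fun u => ∫ s in a..u, f s) (f x) (Icc a b) x := by
  have := Fact.mk hx
  exact intervalIntegral.integral_hasDerivWithinAt_right
    ((hf.mono (Icc_subset_Icc le_rfl hx.2)).intervalIntegrable_of_Icc hx.1)
    (hf.stronglyMeasurableAtFilter_nhdsWithin measurableSet_Icc x) (hf x hx)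

/-- The primitive `u ↦ ∫ᵤᵇ f` of a function continuous on `[a, b]` has derivative `-f` within
`[a, b]`, endpoints included. -/
theorem hasDerivWithinAt_integral_left_of_continuousOn_Icc {f : ℝ → ℂ} {a b x : ℝ}
    (hf : ContinuousOn f (Icc a b)) (hx : x ∈ Icc a b) :
    HasDerivWithinAt (fun u => ∫ s in u..b, f s) (-f x) (Icc a b) x := by
  have := Fact.mk hx
  exact intervalIntegral.integral_hasDerivWithinAt_left
    ((hf.mono (Icc_subset_Icc hx.1 le_rfl)).intervalIntegrable_of_Icc hx.2)
    (hf.stronglyMeasurableAtFilter_nhdsWithin measurableSet_Icc x) (hf x hx)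

/-- Exchange of the order of integration over a triangle. -/
theorem integral_mul_integral_triangle_swap {p q : ℝ → ℂ} {a b : ℝ} (hab : a ≤ b)
    (hp : ContinuousOn p (Icc a b)) (hq : ContinuousOn q (Icc a b)) :
    ∫ t in a..b, q t * ∫ s in a..t, p s = ∫ t in a..b, p t * ∫ s in t..b, q s := by
  have h := intervalIntegral.integral_mul_deriv_eq_deriv_mul_of_hasDerivWithinAt
    (u := fun t => ∫ s in t..b, q s) (v := fun t => ∫ s in a..t, p s)
    (u' := fun t => -q t) (v' := p) (a := a) (b := b)
    (by rw [uIcc_of_le hab]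
        exact fun x hx => hasDerivWithinAt_integral_left_of_continuousOn_Icc hq hx)
    (by rw [uIcc_of_le hab]
        exact fun x hx => hasDerivWithinAt_integral_right_of_continuousOn_Icc hp hx)
    (hq.neg.intervalIntegrable_of_Icc hab) (hp.intervalIntegrable_of_Icc hab)
  simp only [intervalIntegral.integral_same, zero_mul, mul_zero, sub_self, neg_mul,
    intervalIntegral.integral_neg, sub_neg_eq_add, zero_add] at h
  rw [← h]
  exact intervalIntegral.integral_congr fun t _ => mul_comm _ _

/-- The convolution of `F` with `s ↦ e^{-iωs}`, written through a primitive of `e^{iωs} F(s)`. -/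
theorem integral_exp_mul_comp_sub (ω t : ℝ) (F : ℝ → ℂ) :
    ∫ s in (0 : ℝ)..t, Complex.exp (-(Complex.I * (ω : ℂ) * (s : ℂ))) * F (t - s) =
      Complex.exp (-(Complex.I * ω * t)) *
        ∫ s in (0 : ℝ)..t, Complex.exp (Complex.I * ω * s) * F s := by
  have h := intervalIntegral.integral_comp_sub_left (a := 0) (b := t)
    (fun s => Complex.exp (-(Complex.I * ω * t)) * (Complex.exp (Complex.I * ω * s) * F s)) t
  rw [sub_self, sub_zero] at h
  rw [← intervalIntegral.integral_const_mul, ← h]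
  refine intervalIntegral.integral_congr fun s _ => ?_
  rw [← mul_assoc, ← Complex.exp_add]
  congr 2
  push_cast
  ring

/-- For a solution `θ` of the Volterra equation of the second kind
`θ'(t) + ∫ₜᵀ e^{−iω(s−t)} (θ(s) − iω θ'(s)) ds = g(t)` with `θ(0) = 0`, and for the
convolution `V(t) = ∫₀ᵗ e^{−iωs} F(t−s) ds`, the pairing identity
`∫₀ᵀ (θ V + θ' V') dt = ∫₀ᵀ g F dt` holds. -/
theorem stmt_6 (T : ℝ) (hT : 0 < T) (ω : ℝ) (g F θ : ℝ → ℂ)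
    (hg : ContinuousOn g (Icc 0 T)) (hF : ContinuousOn F (Icc 0 T))
    (hθ : ContDiffOn ℝ 1 θ (Icc 0 T)) (hθ0 : θ 0 = 0)
    (hVolterra : ∀ t ∈ Icc 0 T,
      derivWithin θ (Icc 0 T) t +
        (∫ s in t..T, Complex.exp (-(Complex.I * (ω : ℂ) * ((s : ℂ) - (t : ℂ)))) *
          (θ s - Complex.I * (ω : ℂ) * derivWithin θ (Icc 0 T) s)) = g t)
    (V : ℝ → ℂ)
    (hV : ∀ t : ℝ, V t = ∫ s in (0:ℝ)..t, Complex.exp (-(Complex.I * (ω : ℂ) * (s : ℂ))) * F (t - s)) :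
    ∫ t in (0:ℝ)..T,
        (θ t * V t + derivWithin θ (Icc 0 T) t * derivWithin V (Icc 0 T) t)
      = ∫ t in (0:ℝ)..T, g t * F t := by
  have hle := hT.le
  set D := derivWithin θ (Icc 0 T)
  have hDc : ContinuousOn D (Icc 0 T) :=
    hθ.continuousOn_derivWithin (uniqueDiffOn_Icc hT) le_rfl
  have hθc : ContinuousOn θ (Icc 0 T) := hθ.continuousOn
  set p : ℝ → ℂ := fun s => Complex.exp (Complex.I * ω * s) * F s with hp
  set q : ℝ → ℂ := fun s =>
    Complex.exp (-(Complex.I * ω * s)) * (θ s - Complex.I * ω * D s) with hq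
  have hpc : ContinuousOn p (Icc 0 T) := by
    have : Continuous fun s : ℝ => Complex.exp (Complex.I * ω * s) := by fun_prop
    exact this.continuousOn.mul hF
  have hqc : ContinuousOn q (Icc 0 T) := by
    have : Continuous fun s : ℝ => Complex.exp (-(Complex.I * ω * s)) := by fun_prop
    exact this.continuousOn.mul (hθc.sub (continuousOn_const.mul hDc))
  have hVp : ∀ t, V t = Complex.exp (-(Complex.I * ω * t)) * ∫ s in (0 : ℝ)..t, p s :=
    fun t => (hV t).trans (integral_exp_mul_comp_sub ω t F)
  have hexp : ∀ t : ℝ, Complex.exp (-(Complex.I * ω * t)) * Complex.exp (Complex.I * ω * t) = 1 :=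
    fun t => by rw [← Complex.exp_add, neg_add_cancel, Complex.exp_zero]
  have hV' : ∀ t ∈ Icc 0 T, derivWithin V (Icc 0 T) t = F t - Complex.I * ω * V t := by
    intro t ht
    refine HasDerivWithinAt.derivWithin ?_ (uniqueDiffOn_Icc hT t ht)
    have he : HasDerivAt (fun s : ℝ => Complex.exp (-(Complex.I * ω * s)))
        (Complex.exp (-(Complex.I * ω * t)) * -(Complex.I * ω * 1)) t :=
      (((hasDerivAt_id t).ofReal_comp.const_mul (Complex.I * (ω : ℂ))).neg).cexp
    have h := he.hasDerivWithinAt.mul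
      (hasDerivWithinAt_integral_right_of_continuousOn_Icc hpc ht)
    rw [funext hVp]
    refine h.congr_deriv ?_
    linear_combination F t * hexp t
  have hint : ∀ t : ℝ, (∫ s in t..T, Complex.exp (-(Complex.I * (ω : ℂ) * ((s : ℂ) - (t : ℂ)))) *
      (θ s - Complex.I * (ω : ℂ) * D s)) = Complex.exp (Complex.I * ω * t) * ∫ s in t..T, q s := by
    intro t
    rw [← intervalIntegral.integral_const_mul]
    refine intervalIntegral.integral_congr fun s _ => ?_
    simp only [hq]
    rw [← mul_assoc, ← Complex.exp_add]
    congr 2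
    ring
  have hP : ContinuousOn (fun t => ∫ s in (0 : ℝ)..t, p s) (Icc 0 T) := fun t ht =>
    (hasDerivWithinAt_integral_right_of_continuousOn_Icc hpc ht).continuousWithinAt
  have hQ : ContinuousOn (fun t => ∫ s in t..T, q s) (Icc 0 T) := fun t ht =>
    (hasDerivWithinAt_integral_left_of_continuousOn_Icc hqc ht).continuousWithinAt
  have hDF : IntervalIntegrable (fun t => D t * F t) MeasureTheory.volume 0 T :=
    (hDc.mul hF).intervalIntegrable_of_Icc hle
  have hqP : IntervalIntegrable (fun t => q t * ∫ s in (0 : ℝ)..t, p s)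
      MeasureTheory.volume 0 T := (hqc.mul hP).intervalIntegrable_of_Icc hle
  have hpQ : IntervalIntegrable (fun t => p t * ∫ s in t..T, q s)
      MeasureTheory.volume 0 T := (hpc.mul hQ).intervalIntegrable_of_Icc hle
  calc
    _ = ∫ t in (0 : ℝ)..T, (D t * F t + q t * ∫ s in (0 : ℝ)..t, p s) := by
      refine intervalIntegral.integral_congr fun t ht => ?_
      rw [uIcc_of_le hle] at ht
      simp only [hV' t ht, hVp t, hq]
      ring
    _ = ∫ t in (0 : ℝ)..T, (D t * F t + p t * ∫ s in t..T, q s) := by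
      rw [intervalIntegral.integral_add hDF hqP,
        intervalIntegral.integral_add hDF hpQ,
        integral_mul_integral_triangle_swap hle hpc hqc]
    _ = _ := by
      refine intervalIntegral.integral_congr fun t ht => ?_
      rw [uIcc_of_le hle] at ht
      simp only [← hVolterra t ht, hint t, hp]
      ring
end
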